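/- Let ℋ be a stable ordered-union ultrafilter on FIN. Then Player I does not have a winning strategy in the stability game Γ^Stab(ℋ). -/

import Mathlib

open Set Filter

abbrev FIN : Type := {s : Finset ℕ // s.Nonempty}

def maxF (s : FIN) : ℕ := s.1.max' s.2

def minF (s : FIN) : ℕ := s.1.min' s.2

/-- `s <_b t` iff `max s < min t`. -/
def blt (s t : FIN) : Prop := maxF s < minF t

/-- An infinite block sequence, presented as its increasing enumeration. -/
def IsBlockFun (X : ℕ → FIN) : Prop := ∀ i j : ℕ, i < j → blt (X i) (X j)

/-- A block sequence of length `n`. -/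
def IsBlockSeqN {n : ℕ} (X : Fin n → FIN) : Prop :=
  ∀ i j : Fin n, i < j → blt (X i) (X j)

/-- `[X]` : all unions of finitely many (at least one) members of `X`. -/
def blocks (X : ℕ → FIN) : Set FIN :=
  {s | ∃ F : Finset ℕ, F.Nonempty ∧ s.1 = F.sup fun i => (X i).1}

def IsOrderedUnion (H : Ultrafilter FIN) : Prop :=
  ∀ A : Set FIN, A ∈ H →
    ∃ X : ℕ → FIN, IsBlockFun X ∧ blocks X ∈ H ∧ blocks X ⊆ A

def IsStableOU (H : Ultrafilter FIN) : Prop :=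
  IsOrderedUnion H ∧
    ∀ Xs : ℕ → ℕ → FIN, (∀ n, IsBlockFun (Xs n) ∧ blocks (Xs n) ∈ H) →
      ∃ Y : ℕ → FIN, IsBlockFun Y ∧ blocks Y ∈ H ∧
        ∀ n, ∀ᶠ i in atTop, Y i ∈ blocks (Xs n)

def IsSelective (U : Ultrafilter ℕ) : Prop :=
  ∀ f : ℕ → ℕ, ∃ A : Set ℕ, A ∈ U ∧
    ((∀ x ∈ A, ∀ y ∈ A, f x = f y) ∨ Set.InjOn f A)

/-- `I(s) = {k : min s ≤ k ≤ max s}`. -/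
def Iset (s : FIN) : Set ℕ := Set.Icc (minF s) (maxF s)

/-- `N(X) = ⋃ i, I(X(i))`. -/
def Nset (X : ℕ → FIN) : Set ℕ := ⋃ i, Iset (X i)

/-- Membership in the class `𝒞₀(ℋ)`. -/
def MemC0 (H : Ultrafilter FIN) (U : Ultrafilter ℕ) : Prop :=
  IsSelective U ∧
    ∀ X : ℕ → FIN, IsBlockFun X → blocks X ∈ H →
      ∃ Y : ℕ → FIN, IsBlockFun Y ∧ blocks Y ∈ H ∧ blocks Y ⊆ blocks X ∧
        Nset Y ∉ U

def RKle (U V : Ultrafilter ℕ) : Prop := ∃ f : ℕ → ℕ, Ultrafilter.map f V = U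

def RKequiv (U V : Ultrafilter ℕ) : Prop := RKle U V ∧ RKle V U

/-- Membership in the class `𝒞₁(ℋ)`. -/
def MemC1 (H : Ultrafilter FIN) (U : Ultrafilter ℕ) : Prop :=
  IsSelective U ∧
    ∀ V : Ultrafilter ℕ, IsSelective V → ¬ MemC0 H V → ¬ RKequiv U V

def initSeg {α : Type _} (f : ℕ → α) (n : ℕ) : List α := (List.range n).map f

def interleave (a : ℕ → ℕ) (b : ℕ → FIN) (m : ℕ) : ℕ ⊕ FIN :=
  if m % 2 = 0 then Sum.inl (a (m / 2)) else Sum.inr (b (m / 2))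

/-- Nodes of the tree `𝕋`: a node of length `l` is a sequence whose `k`-th entry
codes a function `𝒫(k) → 2` (coded as a total function `Finset ℕ → Bool`;
only values on subsets of `{0,…,k−1}` matter). -/
abbrev Node : Type := List (Finset ℕ → Bool)

/-- `s⁻ = s \ {max s}`. -/
def sm (s : FIN) : Finset ℕ := s.1.erase (maxF s)

/-- `A` is `(k,s)`-big. -/
def IsBig (k : ℕ) (s : FIN) (A : Set (Finset ℕ → Bool)) : Prop :=
  ∀ σ : Finset ℕ → Bool, ∃ τ ∈ A, ∀ u ⊆ Finset.range k, σ u = τ (u ∪ sm s)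

def succT (T : Set Node) (f : Node) : Set (Finset ℕ → Bool) := {τ | f ++ [τ] ∈ T}

/-- `H_{p,k}`. -/
def Hset (T : Set Node) (k : ℕ) : Set FIN :=
  {s | k ≤ maxF s ∧ ∀ f ∈ T, f.length = maxF s → IsBig k s (succT T f)}

/-- `T` is an `ℋ`-condition, i.e. a member of `ℙ(ℋ)`. -/
def IsCond (H : Ultrafilter FIN) (T : Set Node) : Prop :=
  (∀ g ∈ T, ∀ n, g.take n ∈ T) ∧ ([] : Node) ∈ T ∧
    (∀ f ∈ T, ∀ n : ℕ, f.length ≤ n → ∃ g ∈ T, f <+: g ∧ n ≤ g.length) ∧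
    ∀ k : ℕ, Hset T k ∈ H

/-- `T⟨f⟩`. -/
def Tsub (T : Set Node) (f : Node) : Set Node := {g ∈ T | f <+: g ∨ g <+: f}

/-- The constraint linking consecutive moves of Player I in `Γ^Cond(ℋ)`. -/
def StepOK (H : Ultrafilter FIN) (p : Set Node) (s : FIN) (p' : Set Node) : Prop :=
  ∃ q : Node → Set Node,
    (∀ e ∈ p, e.length = maxF s + 1 → IsCond H (q e) ∧ q e ⊆ Tsub p e) ∧
    p' = ⋃ e ∈ {e : Node | e ∈ p ∧ e.length = maxF s + 1}, q e


namespace StabAux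

lemma minF_le (s : FIN) {k : ℕ} (hk : k ∈ s.1) : minF s ≤ k := Finset.min'_le _ _ hk
lemma le_maxF (s : FIN) {k : ℕ} (hk : k ∈ s.1) : k ≤ maxF s := Finset.le_max' _ _ hk
lemma minF_mem (s : FIN) : minF s ∈ s.1 := Finset.min'_mem _ _
lemma maxF_mem (s : FIN) : maxF s ∈ s.1 := Finset.max'_mem _ _
lemma minF_le_maxF (s : FIN) : minF s ≤ maxF s := minF_le s (maxF_mem s)

/-- elements followed by a large gap (the maximum included) -/
def L (f : ℕ → ℕ) (s : Finset ℕ) : Finset ℕ :=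
  s.filter fun m => ∀ k ∈ s, m < k → f m < k

lemma L_gap (f : ℕ → ℕ) (s t : FIN) (h : blt s t) (hf : f (maxF s) < minF t) :
    (L f (s.1 ∪ t.1)).card = (L f s.1).card + (L f t.1).card := by
  have hst : ∀ a ∈ s.1, ∀ b ∈ t.1, a < b := fun a ha b hb =>
    lt_of_le_of_lt (le_maxF s ha) (lt_of_lt_of_le h (minF_le t hb))
  rw [← Finset.card_union_of_disjoint]
  · congr 1
    ext m
    simp only [L, Finset.mem_filter, Finset.mem_union]
    constructor
    · rintro ⟨hm | hm, h2⟩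
      · exact Or.inl ⟨hm, fun k hk => h2 k (Or.inl hk)⟩
      · exact Or.inr ⟨hm, fun k hk => h2 k (Or.inr hk)⟩
    · rintro (⟨hm, h2⟩ | ⟨hm, h2⟩)
      · refine ⟨Or.inl hm, ?_⟩
        rintro k (hk | hk) hmk
        · exact h2 k hk hmk
        · rcases (le_maxF s hm).eq_or_lt with e | e
          · rw [e]; exact lt_of_lt_of_le hf (minF_le t hk)
          · exact (h2 _ (maxF_mem s) e).trans (hst _ (maxF_mem s) _ hk)
      · refine ⟨Or.inr hm, ?_⟩
        rintro k (hk | hk) hmk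
        · exact absurd (hst _ hk _ hm) (by omega)
        · exact h2 k hk hmk
  · rw [Finset.disjoint_left]
    intro a ha hb
    exact absurd (hst a (Finset.mem_filter.1 ha).1 a (Finset.mem_filter.1 hb).1) (lt_irrefl _)

lemma L_nogap (f : ℕ → ℕ) (s t : FIN) (h : blt s t) (hf : ¬ f (maxF s) < minF t) :
    (L f (s.1 ∪ t.1)).card + 1 = (L f s.1).card + (L f t.1).card := by
  have hst : ∀ a ∈ s.1, ∀ b ∈ t.1, a < b := fun a ha b hb =>
    lt_of_le_of_lt (le_maxF s ha) (lt_of_lt_of_le h (minF_le t hb))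
  have hmax : maxF s ∈ L f s.1 := by
    simp only [L, Finset.mem_filter]
    exact ⟨maxF_mem s, fun k hk hlt => absurd (le_maxF s hk) (by omega)⟩
  have e : L f (s.1 ∪ t.1) = (L f s.1).erase (maxF s) ∪ L f t.1 := by
    ext m
    simp only [L, Finset.mem_filter, Finset.mem_union, Finset.mem_erase]
    constructor
    · rintro ⟨hm | hm, h2⟩
      · refine Or.inl ⟨?_, hm, fun k hk => h2 k (Or.inl hk)⟩
        rintro rfl
        exact hf (h2 _ (Or.inr (minF_mem t)) h)
      · exact Or.inr ⟨hm, fun k hk => h2 k (Or.inr hk)⟩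
    · rintro (⟨hne, hm, h2⟩ | ⟨hm, h2⟩)
      · refine ⟨Or.inl hm, ?_⟩
        rintro k (hk | hk) hmk
        · exact h2 k hk hmk
        · have e := lt_of_le_of_ne (le_maxF s hm) hne
          exact (h2 _ (maxF_mem s) e).trans (hst _ (maxF_mem s) _ hk)
      · refine ⟨Or.inr hm, ?_⟩
        rintro k (hk | hk) hmk
        · exact absurd (hst _ hk _ hm) (by omega)
        · exact h2 k hk hmk
  rw [e, Finset.card_union_of_disjoint, ← Finset.card_erase_add_one hmax]
  · omega
  · rw [Finset.disjoint_left]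
    intro a ha hb
    exact absurd (hst a (Finset.mem_filter.1 (Finset.mem_of_mem_erase ha)).1 a
      (Finset.mem_filter.1 hb).1) (lt_irrefl _)

lemma mem_blocks (X : ℕ → FIN) (i : ℕ) : X i ∈ blocks X :=
  ⟨{i}, by simp, by simp⟩

lemma union_mem_blocks (X : ℕ → FIN) (i j : ℕ) :
    (⟨(X i).1 ∪ (X j).1, (X i).2.mono Finset.subset_union_left⟩ : FIN) ∈ blocks X :=
  ⟨{i, j}, by simp, by simp [Finset.sup_insert]⟩

lemma le_minF (X : ℕ → FIN) (hX : IsBlockFun X) (n : ℕ) : n ≤ minF (X n) := by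
  induction n with
  | zero => exact Nat.zero_le _
  | succ n ih =>
    have h1 := hX n (n + 1) (Nat.lt_succ_self n)
    have h2 := minF_le_maxF (X n)
    unfold blt at h1
    omega

/-- The parity trick: sparse sequences. -/
lemma even_mem (H : Ultrafilter FIN) (hH : IsOrderedUnion H) (f : ℕ → ℕ) :
    {s : FIN | (L f s.1).card % 2 = 0} ∈ H := by
  by_contra hc
  have hc' := Ultrafilter.compl_mem_iff_notMem.2 hc
  obtain ⟨X, hX, -, hsub⟩ := hH _ hc'
  have h0 := hsub (mem_blocks X 0)
  have h1 := hsub (mem_blocks X (f (maxF (X 0)) + 1))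
  have h2 := hsub (union_mem_blocks X 0 (f (maxF (X 0)) + 1))
  have h3 := L_gap f _ _ (hX 0 (f (maxF (X 0)) + 1) (Nat.succ_pos _))
    (le_minF X hX (f (maxF (X 0)) + 1))
  simp only [Set.mem_compl_iff, Set.mem_ofPred_eq] at h0 h1 h2
  omega

lemma sparse (X : ℕ → FIN) (hX : IsBlockFun X) (f : ℕ → ℕ)
    (h : blocks X ⊆ {s : FIN | (L f s.1).card % 2 = 0}) {i j : ℕ} (hij : i < j) :
    f (maxF (X i)) < minF (X j) := by
  by_contra hc
  have h0 := h (mem_blocks X i)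
  have h1 := h (mem_blocks X j)
  have h2 := h (union_mem_blocks X i j)
  have h3 := L_nogap f _ _ (hX i j hij) hc
  simp only [Set.mem_ofPred_eq] at h0 h1 h2
  omega

lemma blocks_of_tail (X Y : ℕ → FIN) (hY : IsBlockFun Y) (N : ℕ)
    (hN : ∀ i, N ≤ i → Y i ∈ blocks X) (t : FIN) (ht : t ∈ blocks Y)
    (hlt : maxF (Y N) < minF t) : t ∈ blocks X := by
  obtain ⟨F, hF, e⟩ := ht
  have hge : ∀ i ∈ F, N ≤ i := by
    intro i hi
    by_contra hc
    have h1 := hY i N (by omega)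
    have h2 : minF t ≤ minF (Y i) := by
      apply minF_le
      rw [e, Finset.mem_sup]
      exact ⟨i, hi, minF_mem _⟩
    have h3 := minF_le_maxF (Y i)
    have h4 := minF_le_maxF (Y N)
    unfold blt at h1
    omega
  choose! G hG1 hG2 using hN
  refine ⟨F.biUnion G, ?_, ?_⟩
  · obtain ⟨i, hi⟩ := hF
    obtain ⟨k, hk⟩ := hG1 i (hge i hi)
    exact ⟨k, Finset.mem_biUnion.2 ⟨i, hi, hk⟩⟩
  · rw [e, Finset.sup_biUnion]
    exact Finset.sup_congr rfl fun i hi => hG2 i (hge i hi)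

lemma finite_hist (m : ℕ) : {l : List FIN | l.Nodup ∧ ∀ x ∈ l, maxF x ≤ m}.Finite := by
  classical
  have h1 : {x : FIN | maxF x ≤ m}.Finite := by
    have : ((Finset.range (m + 1)).powerset : Set (Finset ℕ)).Finite := Finset.finite_toSet _
    refine (this.preimage (f := fun x : FIN => x.1) Subtype.val_injective.injOn).subset ?_
    intro x hx
    simp only [Set.mem_preimage, Finset.mem_coe, Finset.mem_powerset]
    intro k hk
    have := le_maxF x hk
    simp only [Set.mem_ofPred_eq] at hx
    simp
    omega
  refine (Finset.finite_toSet (h1.toFinset.powerset.biUnion fun T => T.val.lists.toFinset)).subset ?_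
  rintro l ⟨hl, hm⟩
  simp only [Finset.mem_coe, Finset.mem_biUnion, Finset.mem_powerset]
  refine ⟨l.toFinset, ?_, ?_⟩
  · intro x hx
    simpa using hm x (List.mem_toFinset.1 hx)
  · rw [Multiset.mem_toFinset, Multiset.mem_lists_iff]
    simp [List.toFinset_val, hl.dedup]

end StabAux

open StabAux in
theorem stmt5 (H : Ultrafilter FIN) (hH : IsStableOU H) :
    ¬ ∃ St : List FIN → Set FIN,
        (∀ h : List FIN, St h ∈ H) ∧
        ∀ s : ℕ → FIN, (∀ i, s i ∈ St (initSeg s i)) →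
          ¬ (IsBlockFun s ∧ blocks s ∈ H) := by
  rintro ⟨St, hSt, hwin⟩
  obtain ⟨hOU, hstab⟩ := hH
  choose X hX1 hX2 hX3 using fun h => hOU (St h) (hSt h)
  obtain ⟨e, he⟩ := exists_surjective_nat (List FIN)
  obtain ⟨Y, hY, hYH, hYr⟩ := hstab (fun n => X (e n)) fun n => ⟨hX1 _, hX2 _⟩
  have hN : ∀ h, ∃ N, ∀ i, N ≤ i → Y i ∈ blocks (X h) := by
    intro h
    obtain ⟨n, rfl⟩ := he h
    exact eventually_atTop.1 (hYr n)
  choose N hN using hN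
  let f : ℕ → ℕ := fun m => (finite_hist m).toFinset.sup fun h => maxF (Y (N h))
  obtain ⟨Z, hZ, hZH, hZs⟩ := hOU _ (inter_mem (inter_mem (even_mem H hOU f) hYH) (hSt []))
  refine hwin Z ?_ ⟨hZ, hZH⟩
  intro i
  cases i with
  | zero => exact (hZs (mem_blocks Z 0)).2
  | succ i =>
    have hsp := sparse Z hZ f (fun x hx => (hZs hx).1.1) (Nat.lt_succ_self i)
    apply hX3
    refine blocks_of_tail _ Y hY _ (hN _) _ (hZs (mem_blocks Z (i + 1))).1.2 ?_
    refine lt_of_le_of_lt ?_ hsp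
    have hmem : initSeg Z (i + 1) ∈ (finite_hist (maxF (Z i))).toFinset := by
      simp only [Set.Finite.mem_toFinset, Set.mem_ofPred_eq]
      constructor
      · refine List.Nodup.map ?_ List.nodup_range
        intro a b hab
        by_contra hne
        have key : ∀ a b, a < b → Z a ≠ Z b := by
          intro a b h1 h2
          have h3 := hZ a b h1
          have h4 := minF_le_maxF (Z b)
          unfold blt at h3
          rw [h2] at h3
          omega
        rcases lt_or_gt_of_ne hne with h | h
        · exact key _ _ h hab
        · exact key _ _ h hab.symm
      · intro x hx
        simp only [initSeg, List.mem_map, List.mem_range] at hx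
        obtain ⟨a, ha, rfl⟩ := hx
        rcases (Nat.lt_succ_iff.1 ha).eq_or_lt with h | h
        · rw [h]
        · have h3 := hZ a i h
          have h4 := minF_le_maxF (Z i)
          unfold blt at h3
          omega
    exact Finset.le_sup (f := fun h => maxF (Y (N h))) hmem
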